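/- arXiv:2012.08265 — 2 statements merged into one kernel-verified Lean document; each statement's English description precedes it below -/
import Mathlib

section
/- Let M be exponentially distributed with parameter λ > 0 and suppose 0 = m_0 < m_1 < ⋯ < m_{N−1} < m_N = ∞ is an equilibrium with N ≥ 2 bins for bias b. Define the bin lengths l_k = m_k − m_{k−1} for k = 1, …, N−1, and the functions g(x) = x e^{λx}/(e^{λx} − 1), h(x) = x/(e^{λx} − 1). Then g(l_{N−1}) = 2/λ + 2b, and g(l_k) = 2/λ + 2b − h(l_{k+1}) for k = 1, …, N−2. -/
open MeasureTheory Set Filter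

/-- Conditional mean `E[M | M ∈ s]` of a random variable with density `f`. -/
noncomputable def condMean (f : ℝ → ℝ) (s : Set ℝ) : ℝ :=
  (∫ x in s, x * f x) / (∫ x in s, f x)

/-- The bin (interval) of real numbers between two extended-real edges `lo` and `hi`. -/
def ebin (lo hi : EReal) : Set ℝ := {x : ℝ | lo ≤ (x : EReal) ∧ (x : EReal) < hi}

/-- Edges `m_0 = m_L < m_1 < ⋯ < m_{N−1} < m_N = +∞` of an `N`-bin quantizer with interior
edges `m : Fin (N−1) → ℝ`, for a source supported on `[m_L, ∞)`. -/
noncomputable def edgesL (mL : ℝ) (N : ℕ) (m : Fin (N - 1) → ℝ) (k : ℕ) : EReal :=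
  if hk : k = 0 then (mL : EReal)
  else if h : k ≤ N - 1 then ((m ⟨k - 1, by omega⟩ : ℝ) : EReal)
  else ⊤

/-- `m : Fin (N−1) → ℝ` is the vector of interior edges of an `N`-bin cheap-talk equilibrium
for a source with density `f` supported on `[m_L, ∞)` and bias `b`: the interior edges are
strictly increasing, lie above `m_L`, and every interior edge `m_k` satisfies the
centroid/nearest-neighbor condition
`m_k = (E[M | m_{k−1} ≤ M < m_k] + E[M | m_k ≤ M < m_{k+1}])/2 + b`. -/
def IsEqL (f : ℝ → ℝ) (mL b : ℝ) (N : ℕ) (m : Fin (N - 1) → ℝ) : Prop :=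
  StrictMono m ∧ (∀ k, mL < m k) ∧ ∀ k : Fin (N - 1),
    m k = (condMean f (ebin (edgesL mL N m k.val) (edgesL mL N m (k.val + 1)))
         + condMean f (ebin (edgesL mL N m (k.val + 1)) (edgesL mL N m (k.val + 2)))) / 2 + b

/-- The exponential density with rate `lam`: `f(x) = λ e^{−λx}` for `x ≥ 0`, `0` otherwise. -/
noncomputable def expPDF (lam : ℝ) (x : ℝ) : ℝ :=
  if 0 ≤ x then lam * Real.exp (-lam * x) else 0

/-- The `k`-th interior edge (`1 ≤ k ≤ N−1`) as a real number; `redge N m 0 = 0` matches the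
left endpoint of the support of the exponential source. -/
noncomputable def redge (N : ℕ) (m : Fin (N - 1) → ℝ) (k : ℕ) : ℝ :=
  if h : 1 ≤ k ∧ k ≤ N - 1 then m ⟨k - 1, by omega⟩ else 0

lemma ebin_coe_coe (a c : ℝ) : ebin a c = Ico a c := by
  ext x
  simp [ebin]

lemma ebin_coe_top (a : ℝ) : ebin a ⊤ = Ici a := by
  ext x
  simp [ebin]

lemma hasDerivAt_neg_exp_neg_mul (lam x : ℝ) :
    HasDerivAt (fun x => -Real.exp (-lam * x)) (lam * Real.exp (-lam * x)) x := by
  have h := (((hasDerivAt_id x).const_mul (-lam)).exp).neg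
  refine h.congr_deriv ?_
  simp only [id]
  ring

lemma hasDerivAt_neg_add_inv_mul_exp_neg_mul {lam : ℝ} (hlam : 0 < lam) (x : ℝ) :
    HasDerivAt (fun x => (x + 1 / lam) * -Real.exp (-lam * x))
      (x * (lam * Real.exp (-lam * x))) x := by
  have h := ((hasDerivAt_id x).add_const (1 / lam)).mul (hasDerivAt_neg_exp_neg_mul lam x)
  refine h.congr_deriv ?_
  simp only [id]
  field_simp
  ring

lemma tendsto_neg_exp_neg_mul_atTop {lam : ℝ} (hlam : 0 < lam) :
    Tendsto (fun x => -Real.exp (-lam * x)) atTop (nhds 0) := by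
  have h := (tendsto_rpow_mul_exp_neg_mul_atTop_nhds_zero 0 lam hlam).neg
  simpa using h

lemma tendsto_neg_add_inv_mul_exp_neg_mul_atTop {lam : ℝ} (hlam : 0 < lam) :
    Tendsto (fun x => (x + 1 / lam) * -Real.exp (-lam * x)) atTop (nhds 0) := by
  have h := ((tendsto_rpow_mul_exp_neg_mul_atTop_nhds_zero 1 lam hlam).neg).add
    ((tendsto_neg_exp_neg_mul_atTop hlam).const_mul (1 / lam))
  simp only [Real.rpow_one, mul_zero, neg_zero, add_zero] at h
  refine h.congr fun x => ?_
  ring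

lemma condMean_expPDF_of_subset_Ici {lam : ℝ} {s : Set ℝ} (hs : MeasurableSet s)
    (hs0 : s ⊆ Ici 0) :
    condMean (expPDF lam) s = (∫ x in s, x * (lam * Real.exp (-lam * x))) /
      ∫ x in s, lam * Real.exp (-lam * x) := by
  have h : ∀ x ∈ s, expPDF lam x = lam * Real.exp (-lam * x) := fun x hx => if_pos (hs0 hx)
  rw [condMean, setIntegral_congr_fun hs h]
  congr 1
  exact setIntegral_congr_fun hs fun x hx => by simp only [h x hx]

/-- The mean excess of an exponential variable over any threshold is `1 / λ`. -/
lemma condMean_expPDF_Ici {lam a : ℝ} (hlam : 0 < lam) (ha : 0 ≤ a) :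
    condMean (expPDF lam) (Ici a) = 1 / lam + a := by
  rw [condMean_expPDF_of_subset_Ici measurableSet_Ici (Ici_subset_Ici.2 ha),
    integral_Ici_eq_integral_Ioi, integral_Ici_eq_integral_Ioi,
    integral_Ioi_of_hasDerivAt_of_nonneg'
      (fun x _ => hasDerivAt_neg_add_inv_mul_exp_neg_mul hlam x)
      (fun x hx => mul_nonneg (ha.trans (mem_Ioi.1 hx).le) (by positivity))
      (tendsto_neg_add_inv_mul_exp_neg_mul_atTop hlam),
    integral_Ioi_of_hasDerivAt_of_nonneg' (fun x _ => hasDerivAt_neg_exp_neg_mul lam x)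
      (fun x _ => by positivity) (tendsto_neg_exp_neg_mul_atTop hlam)]
  have := Real.exp_ne_zero (-lam * a)
  field_simp
  ring

/-- The mean of an exponential variable conditioned on a bounded interval. -/
lemma condMean_expPDF_Ico {lam a c : ℝ} (hlam : 0 < lam) (ha : 0 ≤ a) (hac : a < c) :
    condMean (expPDF lam) (Ico a c) =
      1 / lam + a - (c - a) / (Real.exp (lam * (c - a)) - 1) := by
  rw [condMean_expPDF_of_subset_Ici measurableSet_Ico fun x hx => ha.trans hx.1,
    integral_Ico_eq_integral_Ioc, integral_Ico_eq_integral_Ioc,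
    ← intervalIntegral.integral_of_le hac.le, ← intervalIntegral.integral_of_le hac.le,
    intervalIntegral.integral_eq_sub_of_hasDerivAt
      (fun x _ => hasDerivAt_neg_add_inv_mul_exp_neg_mul hlam x)
      (Continuous.intervalIntegrable (by fun_prop) _ _),
    intervalIntegral.integral_eq_sub_of_hasDerivAt
      (fun x _ => hasDerivAt_neg_exp_neg_mul lam x)
      (Continuous.intervalIntegrable (by fun_prop) _ _)]
  have hexp : Real.exp (-lam * a) = Real.exp (lam * (c - a)) * Real.exp (-lam * c) := by
    rw [← Real.exp_add]
    ring_nf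
  have hone : 1 < Real.exp (lam * (c - a)) :=
    Real.one_lt_exp_iff.2 (mul_pos hlam (sub_pos.2 hac))
  have hc := Real.exp_pos (-lam * c)
  rw [hexp]
  generalize Real.exp (lam * (c - a)) = E at *
  generalize Real.exp (-lam * c) = C at *
  have hE : E - 1 ≠ 0 := (sub_pos.2 hone).ne'
  have hden : -C - -(E * C) = (E - 1) * C := by ring
  rw [hden]
  field_simp
  ring

lemma edgesL_zero_eq_redge {N k : ℕ} (m : Fin (N - 1) → ℝ) (hk : k ≤ N - 1) :
    edgesL 0 N m k = (redge N m k : EReal) := by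
  rcases Nat.eq_zero_or_pos k with rfl | hpos
  · simp [edgesL, redge]
  · simp [edgesL, redge, hpos.ne', hk, Nat.one_le_iff_ne_zero]

lemma edgesL_eq_top {N k : ℕ} (mL : ℝ) (m : Fin (N - 1) → ℝ) (hk0 : k ≠ 0) (hk : N - 1 < k) :
    edgesL mL N m k = ⊤ := by
  simp [edgesL, hk0, hk.not_ge]

lemma redge_succ {N k : ℕ} (m : Fin (N - 1) → ℝ) (hk : k < N - 1) :
    redge N m (k + 1) = m ⟨k, hk⟩ :=
  dif_pos ⟨k.succ_pos, hk⟩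

lemma redge_nonneg {N : ℕ} {m : Fin (N - 1) → ℝ} (hm : ∀ k, 0 < m k) (k : ℕ) :
    0 ≤ redge N m k := by
  unfold redge
  split_ifs
  exacts [(hm _).le, le_rfl]

lemma redge_lt_redge_succ {N k : ℕ} {m : Fin (N - 1) → ℝ} (hmono : StrictMono m)
    (hm : ∀ k, 0 < m k) (hk : k < N - 1) : redge N m k < redge N m (k + 1) := by
  rw [redge_succ m hk]
  cases k with
  | zero => simpa [redge] using hm ⟨0, hk⟩
  | succ k =>
    rw [redge_succ m (by omega)]
    exact hmono (Fin.mk_lt_mk.2 k.lt_succ_self)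

lemma mul_exp_div_exp_sub_one {lam x : ℝ} (hlam : 0 < lam) (hx : 0 < x) :
    x * Real.exp (lam * x) / (Real.exp (lam * x) - 1) =
      x + x / (Real.exp (lam * x) - 1) := by
  have : Real.exp (lam * x) - 1 ≠ 0 :=
    (sub_pos.2 (Real.one_lt_exp_iff.2 (mul_pos hlam hx))).ne'
  generalize Real.exp (lam * x) = E at *
  field_simp
  ring

/-- For an exponential source with parameter `λ > 0` at an `N`-bin
equilibrium (`N ≥ 2`) with bias `b`, the bin lengths `l_k = m_k − m_{k−1}` satisfy
`g(l_{N−1}) = 2/λ + 2b` and `g(l_k) = 2/λ + 2b − h(l_{k+1})` for `k = 1, …, N−2`, where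
`g(x) = x e^{λx}/(e^{λx} − 1)` and `h(x) = x/(e^{λx} − 1)`. -/
theorem exp_equilibrium_recursion (lam b : ℝ) (hlam : 0 < lam)
    (N : ℕ) (hN : 2 ≤ N) (m : Fin (N - 1) → ℝ)
    (heq : IsEqL (expPDF lam) 0 b N m)
    (l : ℕ → ℝ) (hl : ∀ k, l k = redge N m k - redge N m (k - 1))
    (g h : ℝ → ℝ)
    (hg : ∀ x, g x = x * Real.exp (lam * x) / (Real.exp (lam * x) - 1))
    (hh : ∀ x, h x = x / (Real.exp (lam * x) - 1)) :
    g (l (N - 1)) = 2 / lam + 2 * b ∧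
    ∀ k, 1 ≤ k → k ≤ N - 2 → g (l k) = 2 / lam + 2 * b - h (l (k + 1)) := by
  obtain ⟨hmono, hpos, hnn⟩ := heq
  have hcond : ∀ k, k < N - 1 →
      condMean (expPDF lam) (ebin (edgesL 0 N m k) (edgesL 0 N m (k + 1))) =
        1 / lam + redge N m k - h (l (k + 1)) := by
    intro k hk
    rw [edgesL_zero_eq_redge m hk.le, edgesL_zero_eq_redge m hk, ebin_coe_coe,
      condMean_expPDF_Ico hlam (redge_nonneg hpos k) (redge_lt_redge_succ hmono hpos hk),
      hh, hl, Nat.add_sub_cancel]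
  have hstep : ∀ k, k < N - 1 → ∀ d,
      condMean (expPDF lam) (ebin (edgesL 0 N m (k + 1)) (edgesL 0 N m (k + 2))) =
        1 / lam + redge N m (k + 1) - d → g (l (k + 1)) = 2 / lam + 2 * b - d := by
    intro k hk d hd
    have hlpos : 0 < l (k + 1) := by
      rw [hl, Nat.add_sub_cancel]
      exact sub_pos.2 (redge_lt_redge_succ hmono hpos hk)
    have hedge := hnn ⟨k, hk⟩
    rw [hcond k hk, hd, ← redge_succ m hk] at hedge
    rw [hg, mul_exp_div_exp_sub_one hlam hlpos, ← hh]
    have hlk : l (k + 1) = redge N m (k + 1) - redge N m k := hl (k + 1)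
    linear_combination hlk + 2 * hedge
  constructor
  · obtain ⟨k, hk⟩ : ∃ k, N - 1 = k + 1 := ⟨N - 2, by omega⟩
    rw [hk, hstep k (by omega) 0, sub_zero]
    rw [edgesL_zero_eq_redge m hk.ge, edgesL_eq_top 0 m (by omega) (by omega), ebin_coe_top,
      condMean_expPDF_Ici hlam (redge_nonneg hpos _), sub_zero]
  · intro k hk1 hk2
    obtain ⟨k, rfl⟩ : ∃ j, k = j + 1 := ⟨k - 1, by omega⟩
    exact hstep k (by omega) _ (hcond (k + 1) (by omega))
end

section
/- Let M ~ N(μ, σ²) with σ > 0 and let b ≠ 0. Then there exists an equilibrium with infinitely many bins. Concretely, for b > 0 there exists a strictly increasing sequence of bin edges m_1 < m_2 < m_3 < ⋯ with m_i → ∞ such that, setting m_0 = −∞, u_1 = E[M | M < m_1] and u_k = E[M | m_{k−1} ≤ M < m_k] for k ≥ 2, the nearest-neighbor conditions m_k = (u_k + u_{k+1})/2 + b hold for all k ≥ 1; for b < 0 the analogous statement holds with a strictly decreasing sequence of edges tending to −∞ and a right-most bin extending to +∞. -/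
open MeasureTheory Set Filter

/-- The `N(μ, σ²)` Gaussian density. -/
noncomputable def gaussPDF (μ σ : ℝ) (x : ℝ) : ℝ :=
  Real.exp (-(x - μ) ^ 2 / (2 * σ ^ 2)) / (σ * Real.sqrt (2 * Real.pi))

/-- The actions induced by edges `m`: `I (m 0)` for the unbounded bin and `C` for the others. -/
def binAction (I : ℝ → ℝ) (C : ℝ → ℝ → ℝ) (m : ℕ → ℝ) : ℕ → ℝ
  | 0 => I (m 0)
  | k + 1 => C (m k) (m (k + 1))

section MonotoneActions

variable {I : ℝ → ℝ} {C : ℝ → ℝ → ℝ}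

theorem binAction_mono (hI : Monotone I)
    (hC : ∀ a a' c c', a ≤ a' → c ≤ c' → C a c ≤ C a' c') {m n : ℕ → ℝ} (h : ∀ k, m k ≤ n k)
    (k : ℕ) : binAction I C m k ≤ binAction I C n k := by
  cases k with
  | zero => exact hI (h 0)
  | succ k => exact hC _ _ _ _ (h k) (h (k + 1))

theorem binAction_le (hI : ∀ c, I c ≤ c) (hC : ∀ a c, a ≤ c → C a c ≤ c) {m : ℕ → ℝ}
    (hm : Monotone m) (k : ℕ) : binAction I C m k ≤ m k := by
  cases k with
  | zero => exact hI _
  | succ k => exact hC _ _ (hm k.le_succ)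

/-- Knaster–Tarski argument: between a constant subsolution and a supersolution there is a
monotone sequence of edges satisfying the nearest-neighbor conditions. -/
theorem exists_monotone_edges (hI : Monotone I)
    (hC : ∀ a a' c c', a ≤ a' → c ≤ c' → C a c ≤ C a' c')
    (hIle : ∀ c, I c ≤ c) (hCle : ∀ a c, a ≤ c → C a c ≤ c) (hleC : ∀ a c, a ≤ c → a ≤ C a c)
    {b : ℝ} (hb : 0 < b) {l : ℝ} (hl : l ≤ I l + 2 * b) {U : ℕ → ℝ} (hlU : ∀ k, l ≤ U k)
    (hU : ∀ k, (binAction I C U k + binAction I C U (k + 1)) / 2 + b ≤ U k) :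
    ∃ m : ℕ → ℝ, Monotone m ∧
      ∀ k, m k = (binAction I C m k + binAction I C m (k + 1)) / 2 + b := by
  set T : (ℕ → ℝ) → ℕ → ℝ :=
    fun m k => (binAction I C m k + binAction I C m (k + 1)) / 2 + b with hT
  have T_mono : ∀ {m n : ℕ → ℝ}, (∀ k, m k ≤ n k) → ∀ k, T m k ≤ T n k := by
    intro m n h k
    have h1 := binAction_mono hI hC h k
    have h2 := binAction_mono hI hC h (k + 1)
    simp only [hT]
    linarith
  have T_monotone : ∀ {m : ℕ → ℝ}, Monotone m → Monotone (T m) := by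
    intro m hm
    refine monotone_nat_of_le_succ fun k => ?_
    have h1 := binAction_le hIle hCle hm k
    have h2 : m k ≤ binAction I C m (k + 1) := hleC _ _ (hm k.le_succ)
    have h3 := binAction_le hIle hCle hm (k + 1)
    have h4 : m (k + 1) ≤ binAction I C m (k + 1 + 1) := hleC _ _ (hm (k + 1).le_succ)
    simp only [hT]
    linarith
  let S : Set (ℕ → ℝ) := {m | Monotone m ∧ (∀ k, m k ≤ U k) ∧ ∀ k, m k ≤ T m k}
  have hlS : (fun _ => l) ∈ S := by
    refine ⟨monotone_const, hlU, fun k => ?_⟩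
    have hCl : C l l = l := le_antisymm (hCle l l le_rfl) (hleC l l le_rfl)
    cases k <;> simp only [hT, binAction, hCl] <;> linarith
  have : Nonempty S := ⟨⟨_, hlS⟩⟩
  let M : ℕ → ℝ := fun k => ⨆ m : S, m.1 k
  have hbdd : ∀ k, BddAbove (range fun m : S => m.1 k) := by
    rintro k
    refine ⟨U k, ?_⟩
    rintro _ ⟨m, rfl⟩
    exact m.2.2.1 k
  have le_M : ∀ m ∈ S, ∀ k, m k ≤ M k := fun m hm k => le_ciSup (hbdd k) (⟨m, hm⟩ : S)
  have M_mono : Monotone M := fun i j hij =>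
    ciSup_le fun m => (m.2.1 hij).trans (le_M m.1 m.2 j)
  have M_le : ∀ k, M k ≤ U k := fun k => ciSup_le fun m => m.2.2.1 k
  have M_le_T : ∀ k, M k ≤ T M k := fun k =>
    ciSup_le fun m => (m.2.2.2 k).trans (T_mono (le_M m.1 m.2) k)
  have hTM : T M ∈ S :=
    ⟨T_monotone M_mono, fun k => (T_mono M_le k).trans (hU k), T_mono M_le_T⟩
  exact ⟨M, M_mono, fun k => le_antisymm (M_le_T k) (le_M _ hTM k)⟩

theorem strictMono_of_nearest_neighbor
    (hIle : ∀ c, I c ≤ c) (hCle : ∀ a c, a ≤ c → C a c ≤ c) (hleC : ∀ a c, a ≤ c → a ≤ C a c)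
    {b : ℝ} (hb : 0 < b) {m : ℕ → ℝ} (hm : Monotone m)
    (h : ∀ k, m k = (binAction I C m k + binAction I C m (k + 1)) / 2 + b) : StrictMono m := by
  refine strictMono_nat_of_lt_succ fun k => ?_
  by_contra! hk
  have h1 := binAction_le hIle hCle hm k
  have h2 : m k ≤ binAction I C m (k + 1) := hleC _ _ (hm k.le_succ)
  have h3 := binAction_le hIle hCle hm (k + 1)
  have h4 : m (k + 1) ≤ binAction I C m (k + 1 + 1) := hleC _ _ (hm (k + 1).le_succ)
  linarith [h k, h (k + 1)]

theorem tendsto_atTop_of_nearest_neighbor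
    (hleC : ∀ a c, a ≤ c → a ≤ C a c) {b : ℝ} (hb : 0 < b) {m : ℕ → ℝ} (hm : Monotone m)
    (h : ∀ k, m k = (binAction I C m k + binAction I C m (k + 1)) / 2 + b) :
    Tendsto m atTop atTop := by
  rcases tendsto_atTop_of_monotone hm with h1 | ⟨x, hx⟩
  · exact h1
  · exfalso
    have hx1 := (tendsto_add_atTop_iff_nat 1).2 hx
    have hx2 := (tendsto_add_atTop_iff_nat 2).2 hx
    have : x + b ≤ x := by
      refine le_of_tendsto_of_tendsto' (((hx.add hx1).div_const 2).add_const b)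
        (hx1.congr fun k => rfl) (fun k => ?_) |>.trans' (by linarith)
      have h2 : m k ≤ binAction I C m (k + 1) := hleC _ _ (hm k.le_succ)
      have h4 : m (k + 1) ≤ binAction I C m (k + 1 + 1) := hleC _ _ (hm (k + 1).le_succ)
      linarith [h (k + 1)]
    linarith

end MonotoneActions

section CondMean

variable {f : ℝ → ℝ} {s t : Set ℝ} {p : ℝ}

theorem setIntegral_sub_mul (hf : Integrable f) (hxf : Integrable fun x => x * f x)
    (s : Set ℝ) (p : ℝ) :
    ∫ x in s, (x - p) * f x = (∫ x in s, x * f x) - p * ∫ x in s, f x := by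
  simp only [sub_mul]
  rw [integral_sub hxf.integrableOn (hf.const_mul p).integrableOn, integral_const_mul]

theorem condMean_le_iff (hf : Integrable f) (hxf : Integrable fun x => x * f x)
    (hs : 0 < ∫ x in s, f x) : condMean f s ≤ p ↔ ∫ x in s, (x - p) * f x ≤ 0 := by
  rw [condMean, div_le_iff₀ hs, setIntegral_sub_mul hf hxf, sub_nonpos]

theorem le_condMean_iff (hf : Integrable f) (hxf : Integrable fun x => x * f x)
    (hs : 0 < ∫ x in s, f x) : p ≤ condMean f s ↔ 0 ≤ ∫ x in s, (x - p) * f x := by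
  rw [condMean, le_div_iff₀ hs, setIntegral_sub_mul hf hxf, sub_nonneg]

theorem condMean_le_of_forall_le (hf : Integrable f) (hxf : Integrable fun x => x * f x)
    (hf0 : ∀ x, 0 < f x) (hsm : MeasurableSet s) (hs : 0 < ∫ x in s, f x)
    (h : ∀ x ∈ s, x ≤ p) : condMean f s ≤ p :=
  (condMean_le_iff hf hxf hs).2 <| setIntegral_nonpos hsm fun x hx =>
    mul_nonpos_of_nonpos_of_nonneg (sub_nonpos.2 (h x hx)) (hf0 x).le

theorem le_condMean_of_forall_le (hf : Integrable f) (hxf : Integrable fun x => x * f x)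
    (hf0 : ∀ x, 0 < f x) (hsm : MeasurableSet s) (hs : 0 < ∫ x in s, f x)
    (h : ∀ x ∈ s, p ≤ x) : p ≤ condMean f s :=
  (le_condMean_iff hf hxf hs).2 <| setIntegral_nonneg hsm fun x hx =>
    mul_nonneg (sub_nonneg.2 (h x hx)) (hf0 x).le

theorem condMean_union_mem_Icc (hf : Integrable f) (hxf : Integrable fun x => x * f x)
    (hst : Disjoint s t) (htm : MeasurableSet t)
    (hs : 0 < ∫ x in s, f x) (ht : 0 < ∫ x in t, f x) (h : condMean f s ≤ condMean f t) :
    condMean f (s ∪ t) ∈ Icc (condMean f s) (condMean f t) := by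
  simp only [condMean] at h ⊢
  rw [setIntegral_union hst htm hxf.integrableOn hxf.integrableOn,
    setIntegral_union hst htm hf.integrableOn hf.integrableOn]
  rw [div_le_div_iff₀ hs ht] at h
  constructor
  · rw [div_le_div_iff₀ hs (by positivity)]
    linarith
  · rw [div_le_div_iff₀ (by positivity) ht]
    linarith

theorem setIntegral_pos_of_forall_pos (hf : Integrable f) (hf0 : ∀ x, 0 < f x)
    (hs : 0 < volume s) : 0 < ∫ x in s, f x := by
  rw [setIntegral_pos_iff_support_of_nonneg_ae (ae_of_all _ fun x => (hf0 x).le) hf.integrableOn]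
  have : Function.support f = univ := eq_univ_of_forall fun x => (hf0 x).ne'
  simpa [this] using hs

theorem setIntegral_Ico_pos (hf : Integrable f) (hf0 : ∀ x, 0 < f x) {a c : ℝ} (h : a < c) :
    0 < ∫ x in Ico a c, f x :=
  setIntegral_pos_of_forall_pos hf hf0 (by simpa using h)

theorem setIntegral_Iio_pos (hf : Integrable f) (hf0 : ∀ x, 0 < f x) (c : ℝ) :
    0 < ∫ x in Iio c, f x :=
  setIntegral_pos_of_forall_pos hf hf0 (by simp)

theorem condMean_Iio_le (hf : Integrable f) (hxf : Integrable fun x => x * f x)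
    (hf0 : ∀ x, 0 < f x) (c : ℝ) : condMean f (Iio c) ≤ c :=
  condMean_le_of_forall_le hf hxf hf0 measurableSet_Iio (setIntegral_Iio_pos hf hf0 c)
    fun _ hx => le_of_lt hx

theorem condMean_Ico_le (hf : Integrable f) (hxf : Integrable fun x => x * f x)
    (hf0 : ∀ x, 0 < f x) {a c : ℝ} (h : a < c) : condMean f (Ico a c) ≤ c :=
  condMean_le_of_forall_le hf hxf hf0 measurableSet_Ico (setIntegral_Ico_pos hf hf0 h)
    fun _ hx => hx.2.le

theorem le_condMean_Ico (hf : Integrable f) (hxf : Integrable fun x => x * f x)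
    (hf0 : ∀ x, 0 < f x) {a c : ℝ} (h : a < c) : a ≤ condMean f (Ico a c) :=
  le_condMean_of_forall_le hf hxf hf0 measurableSet_Ico (setIntegral_Ico_pos hf hf0 h)
    fun _ hx => hx.1

theorem condMean_Iio_mono (hf : Integrable f) (hxf : Integrable fun x => x * f x)
    (hf0 : ∀ x, 0 < f x) : Monotone fun c => condMean f (Iio c) := by
  intro c d hcd
  rcases hcd.eq_or_lt with rfl | hcd
  · exact le_rfl
  have := (condMean_union_mem_Icc hf hxf (s := Iio c) (t := Ico c d)
    (disjoint_left.2 fun x hx hx' => not_le_of_gt hx hx'.1) measurableSet_Ico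
    (setIntegral_Iio_pos hf hf0 c) (setIntegral_Ico_pos hf hf0 hcd)
    ((condMean_Iio_le hf hxf hf0 c).trans (le_condMean_Ico hf hxf hf0 hcd))).1
  rwa [Iio_union_Ico_eq_Iio hcd.le] at this

theorem condMean_Ico_mem_Icc (hf : Integrable f) (hxf : Integrable fun x => x * f x)
    (hf0 : ∀ x, 0 < f x) {a c d : ℝ} (hac : a < c) (hcd : c < d) :
    condMean f (Ico a d) ∈ Icc (condMean f (Ico a c)) (condMean f (Ico c d)) := by
  have := condMean_union_mem_Icc hf hxf (s := Ico a c) (t := Ico c d)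
    (disjoint_left.2 fun x hx hx' => not_le_of_gt hx.2 hx'.1) measurableSet_Ico
    (setIntegral_Ico_pos hf hf0 hac) (setIntegral_Ico_pos hf hf0 hcd)
    ((condMean_Ico_le hf hxf hf0 hac).trans (le_condMean_Ico hf hxf hf0 hcd))
  rwa [Ico_union_Ico_eq_Ico hac.le hcd.le] at this

/-- The conditional mean on `[a, c)`, extended by `a` to `c ≤ a`; this extension is monotone
in both endpoints. -/
noncomputable def icoMean (f : ℝ → ℝ) (a c : ℝ) : ℝ :=
  if a < c then condMean f (Ico a c) else a

theorem icoMean_of_lt {a c : ℝ} (h : a < c) : icoMean f a c = condMean f (Ico a c) := if_pos h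

theorem icoMean_of_le {a c : ℝ} (h : c ≤ a) : icoMean f a c = a := if_neg h.not_gt

theorem le_icoMean (hf : Integrable f) (hxf : Integrable fun x => x * f x)
    (hf0 : ∀ x, 0 < f x) (a c : ℝ) : a ≤ icoMean f a c := by
  rcases lt_or_ge a c with h | h
  · rw [icoMean_of_lt h]
    exact le_condMean_Ico hf hxf hf0 h
  · rw [icoMean_of_le h]

theorem icoMean_le (hf : Integrable f) (hxf : Integrable fun x => x * f x)
    (hf0 : ∀ x, 0 < f x) {a c : ℝ} (h : a ≤ c) : icoMean f a c ≤ c := by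
  rcases h.lt_or_eq with h | rfl
  · rw [icoMean_of_lt h]
    exact condMean_Ico_le hf hxf hf0 h
  · rw [icoMean_of_le le_rfl]

theorem icoMean_mono (hf : Integrable f) (hxf : Integrable fun x => x * f x)
    (hf0 : ∀ x, 0 < f x) (a a' c c' : ℝ) (ha : a ≤ a') (hc : c ≤ c') :
    icoMean f a c ≤ icoMean f a' c' := by
  rcases le_or_gt c a with h | h
  · rw [icoMean_of_le h]
    exact ha.trans (le_icoMean hf hxf hf0 _ _)
  rcases le_or_gt c' a' with h' | h'
  · rw [icoMean_of_le h']
    exact (icoMean_le hf hxf hf0 h.le).trans (hc.trans h')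
  rw [icoMean_of_lt h, icoMean_of_lt h']
  have h1 : condMean f (Ico a c) ≤ condMean f (Ico a c') := by
    rcases hc.eq_or_lt with rfl | hc
    · exact le_rfl
    · exact (condMean_Ico_mem_Icc hf hxf hf0 h hc).1
  refine h1.trans ?_
  rcases ha.eq_or_lt with rfl | ha
  · exact le_rfl
  · exact (condMean_Ico_mem_Icc hf hxf hf0 ha h').2

theorem condMean_congr_set (h : s =ᵐ[volume] t) : condMean f s = condMean f t := by
  rw [condMean, condMean, setIntegral_congr_set h, setIntegral_congr_set h]

theorem condMean_neg (f : ℝ → ℝ) (s : Set ℝ) :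
    condMean f (Neg.neg ⁻¹' s) = -condMean (fun x => f (-x)) s := by
  have h (g : ℝ → ℝ) : ∫ x in Neg.neg ⁻¹' s, g x = ∫ x in s, g (-x) := by
    simpa using (Measure.measurePreserving_neg (volume : Measure ℝ)).setIntegral_preimage_emb
      (Homeomorph.neg ℝ).measurableEmbedding (fun x => g (-x)) s
  rw [condMean, condMean, h, h]
  simp only [neg_mul, integral_neg, neg_div]

end CondMean

section Gaussian

variable {μ σ : ℝ}

theorem gaussPDF_pos (μ : ℝ) (hσ : 0 < σ) (x : ℝ) : 0 < gaussPDF μ σ x := by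
  unfold gaussPDF
  positivity

theorem hasDerivAt_gaussPDF (μ : ℝ) (hσ : 0 < σ) (x : ℝ) :
    HasDerivAt (gaussPDF μ σ) (-((x - μ) * gaussPDF μ σ x) / σ ^ 2) x := by
  unfold gaussPDF
  have h : HasDerivAt (fun x : ℝ => -(x - μ) ^ 2 / (2 * σ ^ 2)) (-(x - μ) / σ ^ 2) x := by
    refine (((((hasDerivAt_id x).sub_const μ).pow 2).neg).div_const (2 * σ ^ 2)).congr_deriv ?_
    simp only [id]
    field_simp
    norm_num
    ring
  refine (h.exp.div_const _).congr_deriv ?_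
  field_simp

theorem continuous_gaussPDF (μ σ : ℝ) : Continuous (gaussPDF μ σ) := by
  unfold gaussPDF
  fun_prop

theorem integrable_sub_pow_mul_gaussPDF (μ : ℝ) (hσ : 0 < σ) (n : ℕ) :
    Integrable fun x => (x - μ) ^ n * gaussPDF μ σ x := by
  have h := integrable_rpow_mul_exp_neg_mul_sq (b := 1 / (2 * σ ^ 2)) (by positivity)
    (s := n) (by linarith [(Nat.cast_nonneg n : (0 : ℝ) ≤ n)])
  simp only [Real.rpow_natCast] at h
  refine ((h.comp_sub_right μ).div_const (σ * Real.sqrt (2 * Real.pi))).congr (ae_of_all _ ?_)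
  intro x
  simp only [gaussPDF, mul_div_assoc]
  congr 3
  ring

theorem integrable_gaussPDF (μ : ℝ) (hσ : 0 < σ) : Integrable (gaussPDF μ σ) := by
  simpa using integrable_sub_pow_mul_gaussPDF μ hσ 0

theorem integrable_mul_gaussPDF (μ : ℝ) (hσ : 0 < σ) :
    Integrable fun x => x * gaussPDF μ σ x := by
  refine ((integrable_sub_pow_mul_gaussPDF μ hσ 1).add
    ((integrable_gaussPDF μ hσ).const_mul μ)).congr (ae_of_all _ fun x => ?_)
  simp only [Pi.add_apply]
  ring

theorem hasDerivAt_sub_mul_gaussPDF (μ : ℝ) (hσ : 0 < σ) (a x : ℝ) :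
    HasDerivAt (fun x => -(σ ^ 2 * ((x - a) * gaussPDF μ σ x)))
      (((x - a) * (x - μ) - σ ^ 2) * gaussPDF μ σ x) x := by
  refine ((((hasDerivAt_id x).sub_const a).mul (hasDerivAt_gaussPDF μ hσ x)).const_mul
    (σ ^ 2)).neg.congr_deriv ?_
  simp only [id]
  field_simp
  ring

theorem condMean_gaussPDF_Iio_le_mean (μ : ℝ) (hσ : 0 < σ) (c : ℝ) :
    condMean (gaussPDF μ σ) (Iio c) ≤ μ := by
  have hf := integrable_gaussPDF μ hσ
  rw [condMean_le_iff hf (integrable_mul_gaussPDF μ hσ)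
    (setIntegral_Iio_pos hf (gaussPDF_pos μ hσ) c), ← integral_Iic_eq_integral_Iio]
  have hd (x : ℝ) : HasDerivAt (fun x => -(σ ^ 2 * gaussPDF μ σ x))
      ((x - μ) * gaussPDF μ σ x) x := by
    refine (((hasDerivAt_gaussPDF μ hσ x).const_mul (σ ^ 2)).neg).congr_deriv ?_
    field_simp
  have hi : IntegrableOn (fun x => (x - μ) * gaussPDF μ σ x) (Iic c) := by
    simpa using (integrable_sub_pow_mul_gaussPDF μ hσ 1).integrableOn
  rw [integral_Iic_of_hasDerivAt_of_tendsto' (fun x _ => hd x) hi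
    (tendsto_zero_of_hasDerivAt_of_integrableOn_Iic (fun x _ => hd x) hi
      (hf.const_mul _).neg.integrableOn)]
  have := gaussPDF_pos μ hσ c
  have : 0 < σ ^ 2 * gaussPDF μ σ c := by positivity
  linarith

theorem sub_le_condMean_gaussPDF_Iio (hσ : 0 < σ) {b c : ℝ} (hc : c < μ)
    (hb : σ ^ 2 ≤ (μ - c) * b) : c - b ≤ condMean (gaussPDF μ σ) (Iio c) := by
  have hf := integrable_gaussPDF μ hσ
  have hxf := integrable_mul_gaussPDF μ hσ
  rw [le_condMean_iff hf hxf (setIntegral_Iio_pos hf (gaussPDF_pos μ hσ) c),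
    ← integral_Iic_eq_integral_Iio]
  have hi : Integrable fun x => ((x - c) * (x - μ) - σ ^ 2) * gaussPDF μ σ x := by
    refine ((integrable_sub_pow_mul_gaussPDF μ hσ 2).add
      (((integrable_sub_pow_mul_gaussPDF μ hσ 1).const_mul (μ - c)).sub
        (hf.const_mul (σ ^ 2)))).congr (ae_of_all _ fun x => ?_)
    simp only [Pi.add_apply, Pi.sub_apply]
    ring
  have hg : Integrable fun x => -(σ ^ 2 * ((x - c) * gaussPDF μ σ x)) := by
    refine ((hxf.sub (hf.const_mul c)).const_mul (-σ ^ 2)).congr (ae_of_all _ fun x => ?_)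
    simp only [Pi.sub_apply]
    ring
  have h0 : ∫ x in Iic c, ((x - c) * (x - μ) - σ ^ 2) * gaussPDF μ σ x = 0 := by
    rw [integral_Iic_of_hasDerivAt_of_tendsto'
      (fun x _ => hasDerivAt_sub_mul_gaussPDF μ hσ c x) hi.integrableOn
      (tendsto_zero_of_hasDerivAt_of_integrableOn_Iic (a := c)
        (fun x _ => hasDerivAt_sub_mul_gaussPDF μ hσ c x) hi.integrableOn hg.integrableOn)]
    simp
  have h1 : 0 ≤ (μ - c) * ∫ x in Iic c, (x - (c - b)) * gaussPDF μ σ x := by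
    rw [← integral_const_mul, ← neg_zero, ← h0, ← integral_neg]
    refine setIntegral_mono_on hi.neg.integrableOn ?_ measurableSet_Iic fun x hx => ?_
    · refine Integrable.integrableOn <|
        ((hxf.sub (hf.const_mul (c - b))).const_mul (μ - c)).congr (ae_of_all _ fun x => ?_)
      simp only [Pi.sub_apply]
      ring
    · rw [← neg_mul, ← mul_assoc]
      refine mul_le_mul_of_nonneg_right ?_ (gaussPDF_pos μ hσ x).le
      have := mul_self_nonneg (x - c)
      nlinarith
  exact nonneg_of_mul_nonneg_right h1 (sub_pos.2 hc)

theorem condMean_gaussPDF_Ico_le_add (hσ : 0 < σ) {a b c : ℝ} (ha : μ < a) (hac : a < c)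
    (hb : σ ^ 2 ≤ (a - μ) * b) : condMean (gaussPDF μ σ) (Ico a c) ≤ a + b := by
  have hf := integrable_gaussPDF μ hσ
  have hxf := integrable_mul_gaussPDF μ hσ
  have hcont := continuous_gaussPDF μ σ
  rw [condMean_le_iff hf hxf (setIntegral_Ico_pos hf (gaussPDF_pos μ hσ) hac),
    integral_Ico_eq_integral_Ioc, ← intervalIntegral.integral_of_le hac.le]
  have h0 : ∫ x in a..c, ((x - a) * (x - μ) - σ ^ 2) * gaussPDF μ σ x ≤ 0 := by
    rw [intervalIntegral.integral_eq_sub_of_hasDerivAt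
      (fun x _ => hasDerivAt_sub_mul_gaussPDF μ hσ a x)
      (Continuous.intervalIntegrable (by fun_prop) _ _)]
    have := gaussPDF_pos μ hσ c
    have := mul_pos (sub_pos.2 hac) this
    have : 0 < σ ^ 2 * ((c - a) * gaussPDF μ σ c) := by positivity
    simp only [sub_self, zero_mul, mul_zero, neg_zero]
    linarith
  have h1 : (a - μ) * ∫ x in a..c, (x - (a + b)) * gaussPDF μ σ x ≤ 0 := by
    rw [← intervalIntegral.integral_const_mul]
    refine (intervalIntegral.integral_mono_on hac.le
      (Continuous.intervalIntegrable (by fun_prop) _ _)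
      (Continuous.intervalIntegrable (by fun_prop) _ _) fun x hx => ?_).trans h0
    rw [← mul_assoc]
    refine mul_le_mul_of_nonneg_right ?_ (gaussPDF_pos μ hσ x).le
    have := mul_self_nonneg (x - a)
    nlinarith
  exact nonpos_of_mul_nonpos_right h1 (sub_pos.2 ha)

theorem gaussPDF_neg (μ σ x : ℝ) : gaussPDF μ σ (-x) = gaussPDF (-μ) σ x := by
  simp only [gaussPDF]
  congr 4
  ring

theorem exists_edges_of_pos (μ : ℝ) (hσ : 0 < σ) {b : ℝ} (hb : 0 < b) :
    ∃ m : ℕ → ℝ, StrictMono m ∧ Tendsto m atTop atTop ∧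
      m 0 = (condMean (gaussPDF μ σ) (Iio (m 0))
           + condMean (gaussPDF μ σ) (Ico (m 0) (m 1))) / 2 + b ∧
      ∀ k : ℕ, m (k + 1) =
        (condMean (gaussPDF μ σ) (Ico (m k) (m (k + 1)))
          + condMean (gaussPDF μ σ) (Ico (m (k + 1)) (m (k + 2)))) / 2 + b := by
  have hf0 := gaussPDF_pos μ hσ
  have hf := integrable_gaussPDF μ hσ
  have hxf := integrable_mul_gaussPDF μ hσ
  have hIle := condMean_Iio_le hf hxf hf0
  have hCle : ∀ a c, a ≤ c → icoMean (gaussPDF μ σ) a c ≤ c := fun a c h => icoMean_le hf hxf hf0 h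
  have hleC : ∀ a c, a ≤ c → a ≤ icoMean (gaussPDF μ σ) a c :=
    fun a c _ => le_icoMean hf hxf hf0 a c
  have hdiv : 0 < σ ^ 2 / b := by positivity
  have hl := sub_le_condMean_gaussPDF_Iio (μ := μ) hσ (b := b) (c := μ - σ ^ 2 / b)
    (by linarith) (by field_simp; linarith)
  set U : ℕ → ℝ := fun k => μ + σ ^ 2 / b + 4 * b * (k + 1) with hUdef
  have hUstep : ∀ k, U (k + 1) = U k + 4 * b := by
    intro k
    simp only [hUdef]
    push_cast
    ring
  have hUge : ∀ k, μ + σ ^ 2 / b + 4 * b ≤ U k := by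
    intro k
    have : 0 ≤ 4 * b * (k : ℝ) := by positivity
    simp only [hUdef]
    linarith
  have hUmean : ∀ k, icoMean (gaussPDF μ σ) (U k) (U (k + 1)) ≤ U k + b := by
    intro k
    have h1 := hUge k
    have h2 : U k < U (k + 1) := by linarith [hUstep k]
    rw [icoMean_of_lt h2]
    refine condMean_gaussPDF_Ico_le_add hσ (by linarith) h2 ?_
    rw [← div_le_iff₀ hb]
    linarith
  obtain ⟨m, hm, h⟩ := exists_monotone_edges (condMean_Iio_mono hf hxf hf0)
    (icoMean_mono hf hxf hf0) hIle hCle hleC hb (l := μ - σ ^ 2 / b) (by linarith) (U := U)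
    (fun k => by linarith [hUge k]) (fun k => by
      cases k with
      | zero =>
        have h1 : binAction (fun c => condMean (gaussPDF μ σ) (Iio c)) (icoMean (gaussPDF μ σ))
          U 0 ≤ μ := condMean_gaussPDF_Iio_le_mean μ hσ (U 0)
        have h2 : binAction (fun c => condMean (gaussPDF μ σ) (Iio c)) (icoMean (gaussPDF μ σ))
          U (0 + 1) ≤ U 0 + b := hUmean 0
        linarith [hUge 0]
      | succ k =>
        have h1 : binAction (fun c => condMean (gaussPDF μ σ) (Iio c)) (icoMean (gaussPDF μ σ))
          U (k + 1) ≤ U k + b := hUmean k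
        have h2 : binAction (fun c => condMean (gaussPDF μ σ) (Iio c)) (icoMean (gaussPDF μ σ))
          U (k + 1 + 1) ≤ U (k + 1) + b := hUmean (k + 1)
        linarith [hUstep k])
  have hstrict := strictMono_of_nearest_neighbor hIle hCle hleC hb hm h
  refine ⟨m, hstrict, tendsto_atTop_of_nearest_neighbor hleC hb hm h, ?_, fun k => ?_⟩
  · have h0 := h 0
    simp only [binAction] at h0
    rwa [icoMean_of_lt (hstrict (Nat.lt_succ_self 0))] at h0
  · have hk := h (k + 1)
    simp only [binAction] at hk
    rwa [icoMean_of_lt (hstrict (Nat.lt_succ_self k)),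
      icoMean_of_lt (hstrict (Nat.lt_succ_self (k + 1)))] at hk

theorem condMean_gaussPDF_Ico_neg (μ σ a c : ℝ) :
    condMean (gaussPDF μ σ) (Ico (-c) (-a)) = -condMean (gaussPDF (-μ) σ) (Ico a c) := by
  have h : Neg.neg ⁻¹' Ico a c =ᵐ[volume] Ico (-c) (-a) := by
    rw [neg_preimage, neg_Ico]
    exact Ioc_ae_eq_Icc.trans Ico_ae_eq_Icc.symm
  rw [← condMean_congr_set h, condMean_neg]
  simp only [gaussPDF_neg]

theorem condMean_gaussPDF_Ici_neg (μ σ c : ℝ) :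
    condMean (gaussPDF μ σ) (Ici (-c)) = -condMean (gaussPDF (-μ) σ) (Iio c) := by
  have h : Neg.neg ⁻¹' Iio c =ᵐ[volume] Ici (-c) := by
    rw [neg_preimage, neg_Iio]
    exact Ioi_ae_eq_Ici
  rw [← condMean_congr_set h, condMean_neg]
  simp only [gaussPDF_neg]

end Gaussian

/-- For a Gaussian source `M ~ N(μ, σ²)` (`σ > 0`) and any bias `b ≠ 0`,
there exists an equilibrium with infinitely many bins: for `b > 0` a strictly increasing
sequence of edges `m_0 < m_1 < ⋯` tending to `∞` (with a left-most bin `(−∞, m_0)`)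
satisfying the centroid/nearest-neighbor conditions at every edge; for `b < 0` a strictly
decreasing sequence of edges tending to `−∞` (with a right-most bin `[m_0, ∞)`). -/
theorem gaussian_infinite_equilibrium (μ σ b : ℝ) (hσ : 0 < σ) (hb : b ≠ 0) :
    (0 < b → ∃ m : ℕ → ℝ, StrictMono m ∧ Tendsto m atTop atTop ∧
      m 0 = (condMean (gaussPDF μ σ) (Iio (m 0))
           + condMean (gaussPDF μ σ) (Ico (m 0) (m 1))) / 2 + b ∧
      ∀ k : ℕ, m (k + 1) =
        (condMean (gaussPDF μ σ) (Ico (m k) (m (k + 1)))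
          + condMean (gaussPDF μ σ) (Ico (m (k + 1)) (m (k + 2)))) / 2 + b) ∧
    (b < 0 → ∃ m : ℕ → ℝ, StrictAnti m ∧ Tendsto m atTop atBot ∧
      m 0 = (condMean (gaussPDF μ σ) (Ico (m 1) (m 0))
           + condMean (gaussPDF μ σ) (Ici (m 0))) / 2 + b ∧
      ∀ k : ℕ, m (k + 1) =
        (condMean (gaussPDF μ σ) (Ico (m (k + 2)) (m (k + 1)))
          + condMean (gaussPDF μ σ) (Ico (m (k + 1)) (m k))) / 2 + b) := by
  refine ⟨fun h => exists_edges_of_pos μ hσ h, fun h => ?_⟩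
  obtain ⟨m, hm, hlim, h0, hk⟩ := exists_edges_of_pos (-μ) hσ (neg_pos.2 h)
  refine ⟨fun k => -m k, hm.neg, tendsto_neg_atTop_atBot.comp hlim, ?_, fun k => ?_⟩
  · simp only [condMean_gaussPDF_Ico_neg, condMean_gaussPDF_Ici_neg]
    linarith
  · simp only [condMean_gaussPDF_Ico_neg]
    linarith [hk k]
end
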